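/- For every n ∈ ℕ with n ≥ 1, the Baernstein norm of the sequence ∑_{i=n}^{2n−1} e_i equals n, which is also its ℓ₁-norm. -/

import Mathlib

open Filter Topology

/-- A finite set of (positive) indices is admissible if it is nonempty and its cardinality
is at most its minimum. -/
def BAdmissible (E : Finset ℕ) : Prop := E.Nonempty ∧ ∀ i ∈ E, E.card ≤ i

/-- The set of values whose supremum defines the Baernstein norm of a real sequence `x`:
all numbers `(∑_{j<k} (∑_{i ∈ E j} |x i|)²)^{1/2}` over finite increasing chains
`E 0 < E 1 < ... < E (k-1)` of admissible sets. -/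
def baernsteinSet (x : ℕ → ℝ) : Set ℝ :=
  {r | ∃ (k : ℕ) (E : ℕ → Finset ℕ),
    (∀ j < k, BAdmissible (E j)) ∧
    (∀ j, j + 1 < k → ∀ a ∈ E j, ∀ b ∈ E (j + 1), a < b) ∧
    r = Real.sqrt (∑ j ∈ Finset.range k, (∑ i ∈ E j, |x i|) ^ 2)}

/-- The Baernstein norm of a real sequence (as a supremum in `ℝ`). -/
noncomputable def baernsteinNorm (x : ℕ → ℝ) : ℝ := sSup (baernsteinSet x)

theorem baern_chain {k : ℕ} {E : ℕ → Finset ℕ} (hA : ∀ j < k, BAdmissible (E j))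
    (hE : ∀ j, j + 1 < k → ∀ a ∈ E j, ∀ b ∈ E (j + 1), a < b) (i d : ℕ) :
    i + d + 1 < k → ∀ a ∈ E i, ∀ b ∈ E (i + d + 1), a < b := by
  induction d with
  | zero => intro h; exact hE i h
  | succ d ih =>
    intro h a ha b hb
    obtain ⟨c, hc⟩ := (hA (i + d + 1) (by omega)).1
    exact (ih (by omega) a ha c hc).trans (hE (i + d + 1) (by omega) c hc b hb)

theorem baern_sum (n : ℕ) (hn : 1 ≤ n) (s : Finset ℕ) :
    ∑ i ∈ s, |if n ≤ i ∧ i ≤ 2 * n - 1 then (1 : ℝ) else 0| =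
      ((s.filter (fun i => i ∈ Finset.Icc n (2 * n - 1))).card : ℝ) := by
  rw [Finset.card_filter]
  push_cast
  refine Finset.sum_congr rfl fun i _ => ?_
  simp only [Finset.mem_Icc]
  split_ifs <;> simp

theorem baern_sum_le (n : ℕ) (hn : 1 ≤ n) (s : Finset ℕ) :
    ∑ i ∈ s, |if n ≤ i ∧ i ≤ 2 * n - 1 then (1 : ℝ) else 0| ≤ n := by
  rw [baern_sum n hn]
  have h : (s.filter (fun i => i ∈ Finset.Icc n (2 * n - 1))).card
      ≤ (Finset.Icc n (2 * n - 1)).card :=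
    Finset.card_le_card fun i hi => (Finset.mem_filter.1 hi).2
  rw [Nat.card_Icc] at h
  exact_mod_cast (by omega : _ ≤ n)

theorem baern_sum_eq (n : ℕ) (hn : 1 ≤ n) :
    ∑ i ∈ Finset.Icc n (2 * n - 1), |if n ≤ i ∧ i ≤ 2 * n - 1 then (1 : ℝ) else 0| = n := by
  rw [baern_sum n hn, Finset.filter_true_of_mem (fun _ h => h), Nat.card_Icc]
  congr 1
  omega

theorem baernsteinNorm_block (n : ℕ) (hn : 1 ≤ n) :
    baernsteinNorm (fun j => if n ≤ j ∧ j ≤ 2 * n - 1 then (1 : ℝ) else 0) = n ∧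
    ∑' j : ℕ, |if n ≤ j ∧ j ≤ 2 * n - 1 then (1 : ℝ) else 0| = n := by
  constructor
  · refine IsGreatest.csSup_eq ⟨⟨1, fun _ => Finset.Icc n (2 * n - 1), ?_, ?_, ?_⟩, ?_⟩
    · intro j _
      refine ⟨⟨n, by simp; omega⟩, fun i hi => ?_⟩
      rw [Nat.card_Icc]
      rw [Finset.mem_Icc] at hi
      omega
    · intro j hj
      omega
    · simp only [Finset.sum_range_one]
      rw [baern_sum_eq n hn, Real.sqrt_sq (Nat.cast_nonneg n)]
    · rintro r ⟨k, E, hA, hE, rfl⟩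
      have hlt : ∀ i j, i < j → j < k → Disjoint (E i) (E j) := by
        intro i j hij hj
        obtain ⟨d, rfl⟩ := Nat.exists_eq_add_of_lt hij
        rw [Finset.disjoint_left]
        intro a ha hb
        exact lt_irrefl a (baern_chain hA hE i d hj a ha a hb)
      have hd : Set.PairwiseDisjoint (↑(Finset.range k)) E := by
        intro i hi j hj hij
        simp only [Finset.coe_range, Set.mem_Iio] at hi hj
        rcases lt_or_gt_of_ne hij with h | h
        · exact hlt i j h hj
        · exact (hlt j i h hi).symm
      refine Real.sqrt_le_iff.2 ⟨Nat.cast_nonneg n, ?_⟩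
      refine (Finset.sum_sq_le_sq_sum_of_nonneg
        fun i _ => Finset.sum_nonneg fun _ _ => abs_nonneg _).trans ?_
      refine pow_le_pow_left₀ (Finset.sum_nonneg fun i _ => Finset.sum_nonneg
        fun _ _ => abs_nonneg _) ?_ 2
      rw [← Finset.sum_biUnion hd]
      exact baern_sum_le n hn _
  · rw [tsum_eq_sum (s := Finset.Icc n (2 * n - 1)), baern_sum_eq n hn]
    intro b hb
    rw [Finset.mem_Icc] at hb
    simp [hb]
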